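/- Every uncrossable set family on a finite set V is semi-uncrossable, and every semi-uncrossable set family on V is γ-pliable (that is, it is pliable and satisfies Property (γ)). -/

import Mathlib

open scoped Classical

namespace SFEC

variable {V : Type*}

/-- An edge (an unordered pair of distinct elements) `e` covers a set `S`
if exactly one endpoint of `e` lies in `S`. -/
def Covers (e : Sym2 V) (S : Set V) : Prop :=
  ∃ u v : V, e = s(u, v) ∧ u ∈ S ∧ v ∉ S

/-- `delta I S` is the set of edges of `I` with exactly one endpoint in `S`. -/
noncomputable def delta (I : Finset (Sym2 V)) (S : Set V) : Finset (Sym2 V) :=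
  I.filter (fun e => Covers e S)

/-- `d I S = |delta I S|`. -/
noncomputable def d (I : Finset (Sym2 V)) (S : Set V) : ℕ := (delta I S).card

/-- A set family on `V`: a collection of subsets with `∅ ∉ F` and `V ∉ F`. -/
def IsSetFamily (F : Set (Set V)) : Prop := ∅ ∉ F ∧ Set.univ ∉ F

/-- `I` covers the family `F` if it covers every member of `F`. -/
def CoversFam (I : Finset (Sym2 V)) (F : Set (Set V)) : Prop := ∀ S ∈ F, 1 ≤ d I S

/-- `I` is an inclusion-minimal cover of `F`. -/
def MinimalCover (I : Finset (Sym2 V)) (F : Set (Set V)) : Prop :=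
  CoversFam I F ∧ ∀ J : Finset (Sym2 V), J ⊂ I → ¬ CoversFam J F

/-- At least two of the four statements hold. -/
def AtLeastTwo (p q r s : Prop) : Prop :=
  (p ∧ q) ∨ (p ∧ r) ∨ (p ∧ s) ∨ (q ∧ r) ∨ (q ∧ s) ∨ (r ∧ s)

/-- A family is pliable if for all `A, B ∈ F` at least two of the four sets
`A ∩ B, A ∪ B, A \ B, B \ A` belong to `F`. -/
def Pliable (F : Set (Set V)) : Prop :=
  ∀ A ∈ F, ∀ B ∈ F, AtLeastTwo (A ∩ B ∈ F) (A ∪ B ∈ F) (A \ B ∈ F) (B \ A ∈ F)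

/-- The residual family `F^I`: the members of `F` covered by no edge of `I`. -/
def Residual (F : Set (Set V)) (I : Finset (Sym2 V)) : Set (Set V) := {S ∈ F | d I S = 0}

/-- `A` and `B` cross if `A ∩ B`, `A \ B`, `B \ A` and `V \ (A ∪ B)` are all nonempty. -/
def Crosses (A B : Set V) : Prop :=
  (A ∩ B).Nonempty ∧ (A \ B).Nonempty ∧ (B \ A).Nonempty ∧ ((A ∪ B)ᶜ : Set V).Nonempty

/-- An `F`-core: an inclusion-minimal member of `F`. -/
def Core (F : Set (Set V)) (C : Set V) : Prop := C ∈ F ∧ ∀ A ∈ F, A ⊆ C → A = C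

/-- Property (γ). -/
def PropertyGamma (F : Set (Set V)) : Prop :=
  ∀ (J : Finset (Sym2 V)) (S₁ S₂ C : Set V),
    S₁ ∈ Residual F J → S₂ ∈ Residual F J → S₁ ⊂ S₂ →
    Core (Residual F J) C → Crosses C S₁ → Crosses C S₂ →
    S₂ \ (S₁ ∪ C) = ∅ ∨ S₂ \ (S₁ ∪ C) ∈ Residual F J

/-- `F` is γ-pliable: pliable and satisfying Property (γ). -/
def GammaPliable (F : Set (Set V)) : Prop := Pliable F ∧ PropertyGamma F

/-- `S` is a witness set for the edge `e ∈ I` if `δ_I(S) = {e}`. -/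
def WitnessSet (F : Set (Set V)) (I : Finset (Sym2 V)) (S : Set V) (e : Sym2 V) : Prop :=
  S ∈ F ∧ delta I S = {e}

/-- `L ⊆ F` is a witness family for `I`: `|L| = |I|` and each `e ∈ I` has a witness set in `L`. -/
def WitnessFamily (F : Set (Set V)) (I : Finset (Sym2 V)) (L : Finset (Set V)) : Prop :=
  ↑L ⊆ F ∧ L.card = I.card ∧ ∀ e ∈ I, ∃ S ∈ L, WitnessSet F I S e

/-- A family is laminar if any two members are disjoint or one contains the other. -/
def Laminar (L : Finset (Set V)) : Prop :=
  ∀ A ∈ L, ∀ B ∈ L, A ⊆ B ∨ B ⊆ A ∨ Disjoint A B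

/-- `S ∈ L` owns `C` if `S` is the inclusion-minimal member of `L` containing `C`. -/
def Owns (L : Finset (Set V)) (S C : Set V) : Prop :=
  S ∈ L ∧ C ⊆ S ∧ ∀ T ∈ L, C ⊆ T → S ⊆ T

/-- `S ∈ L` is hollow if it owns no `F`-core. -/
def Hollow (F : Set (Set V)) (L : Finset (Set V)) (S : Set V) : Prop :=
  S ∈ L ∧ ∀ C : Set V, Core F C → ¬ Owns L S C

/-- `A` is the unique child of `S` in `L`: the unique maximal member of `L`
properly contained in `S`. -/
def UniqueChild (L : Finset (Set V)) (A S : Set V) : Prop :=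
  A ∈ L ∧ A ⊂ S ∧ ∀ B ∈ L, B ⊂ S → B ⊆ A

/-- `(S 0, S 1, …, S ℓ)` is a hollow chain in `L`. -/
def HollowChain (F : Set (Set V)) (L : Finset (Set V)) (S : ℕ → Set V) (ℓ : ℕ) : Prop :=
  (∀ i ≤ ℓ, S i ∈ L) ∧
  (∀ i, 1 ≤ i → i ≤ ℓ → Hollow F L (S i)) ∧
  S ℓ ≠ Set.univ ∧
  (∀ i, 1 ≤ i → i ≤ ℓ → UniqueChild L (S (i - 1)) (S i))

/-- `U`: the union of all `F`-cores. -/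
def coreUnion (F : Set (Set V)) : Set V := ⋃₀ {C | Core F C}

/-- `F` is uncrossable. -/
def Uncrossable (F : Set (Set V)) : Prop :=
  ∀ A ∈ F, ∀ B ∈ F, (A ∩ B ∈ F ∧ A ∪ B ∈ F) ∨ (A \ B ∈ F ∧ B \ A ∈ F)

/-- `F` is semi-uncrossable. -/
def SemiUncrossable (F : Set (Set V)) : Prop :=
  ∀ A ∈ F, ∀ B ∈ F,
    (A ∩ B ∈ F ∧ (A ∪ B ∈ F ∨ A \ B ∈ F ∨ B \ A ∈ F)) ∨ (A \ B ∈ F ∧ B \ A ∈ F)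

end SFEC

open SFEC

namespace SFEC

lemma d_eq_zero_iff {V : Type*} (I : Finset (Sym2 V)) (S : Set V) :
    d I S = 0 ↔ ∀ u v : V, s(u, v) ∈ I → (u ∈ S ↔ v ∈ S) := by
  rw [d, delta, Finset.card_eq_zero, Finset.filter_eq_empty_iff]
  constructor
  · intro h u v huv
    constructor
    · intro hu
      by_contra hv
      exact h huv ⟨u, v, rfl, hu, hv⟩
    · intro hv
      by_contra hu
      exact h huv ⟨v, u, Sym2.eq_swap, hv, hu⟩
  · rintro h e he ⟨u, v, rfl, hu, hv⟩
    exact hv ((h u v he).1 hu)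

lemma Residual.inter_mem {V : Type*} {F : Set (Set V)} {I : Finset (Sym2 V)} {A B : Set V}
    (hA : A ∈ Residual F I) (hB : B ∈ Residual F I) (h : A ∩ B ∈ F) :
    A ∩ B ∈ Residual F I :=
  ⟨h, (d_eq_zero_iff I _).2 fun u v he =>
    and_congr ((d_eq_zero_iff I A).1 hA.2 u v he) ((d_eq_zero_iff I B).1 hB.2 u v he)⟩

lemma Residual.diff_mem {V : Type*} {F : Set (Set V)} {I : Finset (Sym2 V)} {A B : Set V}
    (hA : A ∈ Residual F I) (hB : B ∈ Residual F I) (h : A \ B ∈ F) :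
    A \ B ∈ Residual F I :=
  ⟨h, (d_eq_zero_iff I _).2 fun u v he =>
    and_congr ((d_eq_zero_iff I A).1 hA.2 u v he)
      (not_congr ((d_eq_zero_iff I B).1 hB.2 u v he))⟩

lemma Uncrossable.semiUncrossable {V : Type*} {F : Set (Set V)} (h : Uncrossable F) :
    SemiUncrossable F := fun A hA B hB =>
  (h A hA B hB).imp_left fun h' => ⟨h'.1, Or.inl h'.2⟩

lemma SemiUncrossable.pliable {V : Type*} {F : Set (Set V)} (h : SemiUncrossable F) :
    Pliable F := by
  intro A hA B hB
  have := h A hA B hB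
  unfold AtLeastTwo
  tauto

/-- In a semi-uncrossable family, no core of a residual family crosses a member of it. -/
lemma SemiUncrossable.not_crosses_of_core {V : Type*} {F : Set (Set V)} (h : SemiUncrossable F)
    {I : Finset (Sym2 V)} {C S : Set V} (hC : Core (Residual F I) C) (hS : S ∈ Residual F I) :
    ¬ Crosses C S := by
  rintro ⟨⟨x, hxC, hxS⟩, ⟨y, hyC, hyS⟩, -, -⟩
  rcases h C hC.1.1 S hS.1 with ⟨hi, -⟩ | ⟨hd, -⟩
  · have heq := hC.2 _ (Residual.inter_mem hC.1 hS hi) Set.inter_subset_left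
    exact hyS (Set.inter_eq_left.1 heq hyC)
  · have heq := hC.2 _ (Residual.diff_mem hC.1 hS hd) Set.sdiff_subset
    exact (heq.symm.subset hxC).2 hxS

lemma SemiUncrossable.propertyGamma {V : Type*} {F : Set (Set V)} (h : SemiUncrossable F) :
    PropertyGamma F := fun _ _ _ _ hS₁ _ _ hC hCS₁ _ =>
  (h.not_crosses_of_core hC hS₁ hCS₁).elim

end SFEC

theorem stmt_19 {V : Type*} [Fintype V]
    (F : Set (Set V)) (hF : IsSetFamily F) :
    (Uncrossable F → SemiUncrossable F) ∧ (SemiUncrossable F → GammaPliable F) :=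
  ⟨fun h => h.semiUncrossable, fun h => ⟨h.pliable, h.propertyGamma⟩⟩
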